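/- arXiv:2406.09365 — 6 statements merged into one kernel-verified Lean document; each statement's English description precedes it below -/
import Mathlib

section
/- Let G be a metabelian group whose abelianization G/G' is infinite cyclic, and let a, b ∈ G be elements whose images under the abelianization map G → G/G' are equal and generate G/G'. Then a and b are conjugate in G. -/
/-- Let `G` be a metabelian group (its commutator subgroup `G'` is abelian)
whose abelianization `G/G'` is infinite cyclic, and let `a b : G` have equal images under the
abelianization map which generate `G/G'`.  Then `a` and `b` are conjugate in `G`. -/
theorem stmt_0 {G : Type*} [Group G]
    (hmeta : ∀ x ∈ commutator G, ∀ y ∈ commutator G, x * y = y * x)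
    (e : Abelianization G ≃* Multiplicative ℤ)
    (a b : G)
    (hab : Abelianization.of a = Abelianization.of b)
    (hgen : Subgroup.zpowers (Abelianization.of a) = ⊤) :
    IsConj a b := by
  have hcj : ∀ m ∈ commutator G, ∀ g : G, g * m * g⁻¹ ∈ commutator G :=
    fun m hm g => Subgroup.Normal.conj_mem inferInstance m hm g
  have hker : ∀ x y : G, Abelianization.of x = Abelianization.of y →
      x * y⁻¹ ∈ commutator G := by
    intro x y h
    rw [← Abelianization.ker_of, MonoidHom.mem_ker, map_mul, map_inv, h, mul_inv_cancel]
  let N : Subgroup G :=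
    { carrier := {x | ∃ m ∈ commutator G, x = m * (a * m⁻¹ * a⁻¹)}
      one_mem' := ⟨1, one_mem _, by group⟩
      mul_mem' := by
        rintro _ _ ⟨m, hm, rfl⟩ ⟨n, hn, rfl⟩
        refine ⟨m * n, mul_mem hm hn, ?_⟩
        have h1 := hmeta _ (hcj _ (inv_mem hm) a) _ hn
        have h2 := hmeta _ (inv_mem hm) _ (inv_mem hn)
        calc m * (a * m⁻¹ * a⁻¹) * (n * (a * n⁻¹ * a⁻¹))
            = m * ((a * m⁻¹ * a⁻¹) * n) * (a * n⁻¹ * a⁻¹) := by group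
          _ = m * n * (a * (m⁻¹ * n⁻¹) * a⁻¹) := by rw [h1]; group
          _ = _ := by rw [h2, mul_inv_rev]
      inv_mem' := by
        rintro _ ⟨m, hm, rfl⟩
        refine ⟨m⁻¹, inv_mem hm, ?_⟩
        rw [hmeta _ hm _ (hcj _ (inv_mem hm) a)]
        group }
  have hN : N.Normal := by
    refine ⟨?_⟩
    rintro _ ⟨m, hm, rfl⟩ g
    refine ⟨g * m * g⁻¹, hcj _ hm g, ?_⟩
    have hc : (g * a) * (a * g)⁻¹ ∈ commutator G :=
      hker _ _ (by rw [map_mul, map_mul, mul_comm])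
    have h := hmeta _ hc _ (hcj _ (inv_mem hm) (a * g))
    calc g * (m * (a * m⁻¹ * a⁻¹)) * g⁻¹
        = g * m * g⁻¹ * (((g * a) * (a * g)⁻¹ * (a * g * m⁻¹ * (a * g)⁻¹)) *
            ((g * a) * (a * g)⁻¹)⁻¹) := by group
      _ = _ := by rw [h]; group
  let q := QuotientGroup.mk' N
  have hqa : ∀ m ∈ commutator G, Commute (q m) (q a) := by
    intro m hm
    have : m * (a * m⁻¹ * a⁻¹) ∈ N := ⟨m, hm, rfl⟩
    have h : q (m * (a * m⁻¹ * a⁻¹)) = 1 := (QuotientGroup.eq_one_iff _).2 this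
    have h' : q (m * a) = q (a * m) := by
      calc q (m * a) = q (m * (a * m⁻¹ * a⁻¹)) * q (a * m) := by rw [← map_mul]; congr 1; group
        _ = _ := by rw [h, one_mul]
    simpa [Commute, SemiconjBy] using h'
  have hdec : ∀ g : G, ∃ m ∈ commutator G, ∃ k : ℤ, g = m * a ^ k := by
    intro g
    have : Abelianization.of g ∈ Subgroup.zpowers (Abelianization.of a) := by
      rw [hgen]; trivial
    obtain ⟨k, hk⟩ := this
    refine ⟨g * (a ^ k)⁻¹, hker _ _ ?_, k, by group⟩
    rw [map_zpow]; exact hk.symm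
  have hle : commutator G ≤ N := by
    rw [commutator_def, Subgroup.commutator_le]
    intro x _ y _
    obtain ⟨m, hm, k, rfl⟩ := hdec x
    obtain ⟨n, hn, l, rfl⟩ := hdec y
    rw [← QuotientGroup.eq_one_iff]
    refine (show q _ = 1 from ?_)
    rw [map_commutatorElement, commutatorElement_eq_one_iff_commute]
    simp only [map_mul, map_zpow]
    have hmn : Commute (q m) (q n) := by
      change q m * q n = q n * q m
      rw [← map_mul, hmeta m hm n hn, map_mul]
    exact (hmn.mul_right ((hqa m hm).zpow_right l)).mul_left
      (((hqa n hn).symm.zpow_left k).mul_right ((Commute.refl (q a)).zpow_zpow k l))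
  obtain ⟨m, hm, h⟩ := hle (hker b a hab.symm)
  rw [isConj_iff]
  refine ⟨m, ?_⟩
  calc m * a * m⁻¹ = m * (a * m⁻¹ * a⁻¹) * a := by group
    _ = b := by rw [← h]; group
end

section
/- Let G be a metabelian group and a ∈ G. Then every element of the subgroup [a,G'] of G generated by the set {[a,c] : c ∈ G'} is itself equal to [a,c] for some c ∈ G'. -/
/-- The commutator `[x,y] = x⁻¹y⁻¹xy` (the paper's convention). -/
def pbr {G : Type*} [Group G] (x y : G) : G := x⁻¹ * y⁻¹ * x * y

/-- Let `G` be a metabelian group and `a ∈ G`.  Every element of the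
subgroup `[a,G']` generated by `{[a,c] : c ∈ G'}` equals `[a,c]` for some `c ∈ G'`. -/
theorem stmt_2 {G : Type*} [Group G]
    (hmeta : ∀ x ∈ commutator G, ∀ y ∈ commutator G, x * y = y * x)
    (a g : G)
    (hg : g ∈ Subgroup.closure {x : G | ∃ c ∈ commutator G, x = pbr a c}) :
    ∃ c ∈ commutator G, g = pbr a c := by
  have hconj : ∀ c ∈ commutator G, a⁻¹ * c * a ∈ commutator G := by
    intro c hc
    have hn : (commutator G).Normal := inferInstance
    simpa using hn.conj_mem c hc a⁻¹
  induction hg using Subgroup.closure_induction with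
  | mem x hx => exact hx
  | one => exact ⟨1, one_mem _, by simp [pbr]⟩
  | mul x y _ _ hx hy =>
    obtain ⟨c, hc, rfl⟩ := hx
    obtain ⟨d, hd, rfl⟩ := hy
    refine ⟨d * c, mul_mem hd hc, ?_⟩
    have h1 := hmeta c hc _ (hconj d⁻¹ (inv_mem hd))
    have h2 := hmeta d hd c hc
    calc pbr a c * pbr a d
        = (a⁻¹ * c⁻¹ * a) * (c * (a⁻¹ * d⁻¹ * a)) * d := by
          simp only [pbr]; group
      _ = (a⁻¹ * c⁻¹ * a) * ((a⁻¹ * d⁻¹ * a) * c) * d := by rw [h1]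
      _ = a⁻¹ * (d * c)⁻¹ * a * (c * d) := by group
      _ = pbr a (d * c) := by rw [← h2]; rfl
  | inv x _ hx =>
    obtain ⟨c, hc, rfl⟩ := hx
    refine ⟨c⁻¹, inv_mem hc, ?_⟩
    have h1 := hmeta c⁻¹ (inv_mem hc) _ (hconj c hc)
    calc (pbr a c)⁻¹ = c⁻¹ * (a⁻¹ * c * a) := by simp only [pbr]; group
      _ = (a⁻¹ * c * a) * c⁻¹ := h1
      _ = pbr a c⁻¹ := by simp only [pbr]; group
end

section
/- Let G be a metabelian group and a ∈ G an element whose image under the abelianization map G → G/G' generates the abelianization G/G'. Then G' equals the subgroup [a,G'] of G generated by the set {[a,c] : c ∈ G'}. -/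
/-- Let `G` be a metabelian group and `a ∈ G` an element whose image in the
abelianization `G/G'` generates it.  Then `G'` equals the subgroup `[a,G']` generated by
`{[a,c] : c ∈ G'}`. -/
theorem stmt_4 {G : Type*} [Group G]
    (hmeta : ∀ x ∈ commutator G, ∀ y ∈ commutator G, x * y = y * x)
    (a : G)
    (hgen : Subgroup.zpowers (Abelianization.of a) = ⊤) :
    commutator G = Subgroup.closure {x : G | ∃ c ∈ commutator G, x = pbr a c} := by
  have hpc : ∀ c ∈ commutator G, pbr a c ∈ commutator G := by
    intro c hc
    have h := (inferInstance : (commutator G).Normal).conj_mem c⁻¹ (inv_mem hc) a⁻¹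
    rw [inv_inv] at h
    exact mul_mem h hc
  have hdec : ∀ g : G, ∃ k : ℤ, ∃ d ∈ commutator G, g = a ^ k * d := by
    intro g
    have hg : Abelianization.of g ∈ Subgroup.zpowers (Abelianization.of a) := by
      rw [hgen]; trivial
    obtain ⟨k, hk⟩ := Subgroup.mem_zpowers_iff.1 hg
    refine ⟨k, (a ^ k)⁻¹ * g, ?_, by group⟩
    rw [← Abelianization.ker_of, MonoidHom.mem_ker, map_mul, map_inv, map_zpow, hk,
      inv_mul_cancel]
  have hset : ∀ g : G, ∀ c ∈ commutator G, ∃ c' ∈ commutator G,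
      g * pbr a c * g⁻¹ = pbr a c' := by
    intro g c hc
    obtain ⟨k, d, hd, rfl⟩ := hdec g
    refine ⟨a ^ k * c * (a ^ k)⁻¹,
      (inferInstance : (commutator G).Normal).conj_mem c hc _, ?_⟩
    have h1 : a ^ k * d * pbr a c * (a ^ k * d)⁻¹ = a ^ k * pbr a c * (a ^ k)⁻¹ := by
      rw [mul_assoc (a ^ k) d, hmeta d hd _ (hpc c hc)]
      group
    rw [h1]
    unfold pbr
    have h2 : a ^ k * a = a * a ^ k := (Commute.self_zpow a k).eq.symm
    have h3 : a ^ k * a⁻¹ = a⁻¹ * a ^ k := (Commute.self_zpow a k).inv_left.eq.symm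
    generalize a ^ k = b at h2 h3
    have h4 : a = b * a * b⁻¹ := by rw [h2]; group
    have h5 : a⁻¹ = b * a⁻¹ * b⁻¹ := by rw [h3]; group
    calc b * (a⁻¹ * c⁻¹ * a * c) * b⁻¹
        = (b * a⁻¹ * b⁻¹) * (b * c * b⁻¹)⁻¹ * (b * a * b⁻¹) * (b * c * b⁻¹) := by group
      _ = _ := by rw [← h4, ← h5]
  apply le_antisymm
  · set N := Subgroup.closure {x : G | ∃ c ∈ commutator G, x = pbr a c} with hN
    have hnorm : N.Normal := by
      refine ⟨fun n hn g => ?_⟩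
      have hle : N ≤ N.comap (MulAut.conj g).toMonoidHom := by
        conv_lhs => rw [hN]
        rw [Subgroup.closure_le]
        rintro x ⟨c, hc, rfl⟩
        obtain ⟨c', hc', h⟩ := hset g c hc
        change g * pbr a c * g⁻¹ ∈ N
        rw [h]
        exact Subgroup.subset_closure ⟨c', hc', rfl⟩
      exact hle hn
    have hcomm : ∀ c ∈ commutator G,
        Commute (QuotientGroup.mk' N a) (QuotientGroup.mk' N c) := by
      intro c hc
      have h : QuotientGroup.mk' N (pbr a c) = 1 :=
        (QuotientGroup.eq_one_iff _).2 (Subgroup.subset_closure ⟨c, hc, rfl⟩)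
      have h2 : a * c = c * a * pbr a c := by unfold pbr; group
      have h3 := congrArg (QuotientGroup.mk' N) h2
      rw [map_mul, map_mul, h, mul_one, map_mul] at h3
      exact h3
    have hall : ∀ x y : G, Commute (QuotientGroup.mk' N x) (QuotientGroup.mk' N y) := by
      intro x y
      obtain ⟨k, d, hd, rfl⟩ := hdec x
      obtain ⟨l, e, he, rfl⟩ := hdec y
      have hde : Commute (QuotientGroup.mk' N d) (QuotientGroup.mk' N e) :=
        Commute.map (show Commute d e from hmeta d hd e he) _
      rw [map_mul, map_mul, map_zpow, map_zpow]
      exact Commute.mul_left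
        (Commute.mul_right (Commute.zpow_zpow_self _ _ _) ((hcomm e he).zpow_left k))
        (Commute.mul_right ((hcomm d hd).symm.zpow_right l) hde)
    rw [commutator_def, Subgroup.commutator_le]
    intro x _ y _
    rw [← QuotientGroup.ker_mk' N, MonoidHom.mem_ker, map_commutatorElement]
    exact commutatorElement_eq_one_iff_commute.2 (hall x y)
  · rw [Subgroup.closure_le]
    rintro x ⟨c, hc, rfl⟩
    exact hpc c hc
end

section
/- Let R be a commutative ring, x an invertible element of R, and n a natural number. If n is even then xⁿ − x⁻ⁿ = (x + x⁻¹)·F_n(x − x⁻¹), and if n is odd then xⁿ − x⁻ⁿ = L_n(x − x⁻¹). -/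
/-- The Fibonacci polynomials: `F₀ = 0`, `F₁ = 1`, `F_{n+1} = X·F_n + F_{n−1}`. -/
noncomputable def fibPoly : ℕ → Polynomial ℤ
  | 0 => 0
  | 1 => 1
  | n + 2 => Polynomial.X * fibPoly (n + 1) + fibPoly n

/-- The Lucas polynomials: `L₀ = 2`, `L₁ = X`, `L_{n+1} = X·L_n + L_{n−1}`. -/
noncomputable def lucasPoly : ℕ → Polynomial ℤ
  | 0 => 2
  | 1 => Polynomial.X
  | n + 2 => Polynomial.X * lucasPoly (n + 1) + lucasPoly n

theorem fib_aux {R : Type*} [CommRing R] (x y : R) (h : x * y = 1) (n : ℕ) :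
    x ^ n - (-y) ^ n = (x + y) * Polynomial.aeval (x - y) (fibPoly n) := by
  induction n using Nat.twoStepInduction with
  | zero => simp [fibPoly]
  | one => simp [fibPoly]
  | more n ih1 ih2 =>
    simp only [fibPoly, map_add, map_mul, Polynomial.aeval_X]
    linear_combination (x - y) * ih2 + ih1 + (x ^ n - (-y) ^ n) * h

theorem lucas_aux {R : Type*} [CommRing R] (x y : R) (h : x * y = 1) (n : ℕ) :
    x ^ n + (-y) ^ n = Polynomial.aeval (x - y) (lucasPoly n) := by
  induction n using Nat.twoStepInduction with
  | zero => simp only [lucasPoly, pow_zero, map_ofNat]; norm_num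
  | one => simp [lucasPoly]; ring
  | more n ih1 ih2 =>
    simp only [lucasPoly, map_add, map_mul, Polynomial.aeval_X]
    linear_combination (x - y) * ih2 + ih1 + (x ^ n + (-y) ^ n) * h

/-- For an invertible element `x` of a commutative ring `R`:
if `n` is even then `xⁿ − x⁻ⁿ = (x + x⁻¹)·F_n(x − x⁻¹)`, and if `n` is odd then
`xⁿ − x⁻ⁿ = L_n(x − x⁻¹)`. -/
theorem stmt_13 {R : Type*} [CommRing R] (x : Rˣ) (n : ℕ) :
    (Even n → (x : R) ^ n - (↑x⁻¹ : R) ^ n =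
        ((x : R) + ↑x⁻¹) * Polynomial.aeval ((x : R) - ↑x⁻¹) (fibPoly n)) ∧
    (Odd n → (x : R) ^ n - (↑x⁻¹ : R) ^ n =
        Polynomial.aeval ((x : R) - ↑x⁻¹) (lucasPoly n)) := by
  refine ⟨fun hn => ?_, fun hn => ?_⟩
  · rw [← fib_aux _ _ x.mul_inv n, hn.neg_pow]
  · rw [← lucas_aux _ _ x.mul_inv n, hn.neg_pow, sub_eq_add_neg]
end

section
/- Let R be a commutative ring, let x and y be invertible elements of R, and let r be a natural number. Then x^r·y + (−1)^{r+1}·x^{−r}·y⁻¹ = (y − y⁻¹)·F_{r+1}(x − x⁻¹) + (x⁻¹y + x·y⁻¹)·F_r(x − x⁻¹). -/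
/-- For invertible elements `x`, `y` of a commutative ring `R` and `r : ℕ`:
`x^r·y + (−1)^{r+1}·x^{−r}·y⁻¹ = (y − y⁻¹)·F_{r+1}(x − x⁻¹) + (x⁻¹y + x·y⁻¹)·F_r(x − x⁻¹)`. -/
theorem stmt_14 {R : Type*} [CommRing R] (x y : Rˣ) (r : ℕ) :
    (x : R) ^ r * y + (-1 : R) ^ (r + 1) * (↑x⁻¹ : R) ^ r * ↑y⁻¹ =
      ((y : R) - ↑y⁻¹) * Polynomial.aeval ((x : R) - ↑x⁻¹) (fibPoly (r + 1)) +
        ((↑x⁻¹ : R) * y + (x : R) * ↑y⁻¹) * Polynomial.aeval ((x : R) - ↑x⁻¹) (fibPoly r) := by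
  have h : (x : R) * (↑x⁻¹ : R) = 1 := x.mul_inv
  generalize (↑x⁻¹ : R) = b at *
  generalize (↑y⁻¹ : R) = c at *
  generalize (x : R) = a at *
  generalize (y : R) = d at *
  induction r using Nat.twoStepInduction with
  | zero => simp [fibPoly]; ring
  | one => simp [fibPoly]; ring
  | more r ih0 ih1 =>
    have e : ∀ n, Polynomial.aeval (a - b) (fibPoly (n + 2)) =
        (a - b) * Polynomial.aeval (a - b) (fibPoly (n + 1)) +
          Polynomial.aeval (a - b) (fibPoly n) := by
      intro n
      simp [fibPoly]
    have e1 := e (r + 1)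
    have e0 := e r
    simp only [show r + 1 + 1 = r + 2 from rfl, show r + 1 + 2 = r + 3 from rfl,
      show r + 2 + 1 = r + 3 from rfl] at *
    rw [e1]
    linear_combination (a - b) * ih1 + ih0 + (a ^ r * d + (-1) ^ (r + 1) * b ^ r * c) * h
      - (d * b + a * c) * e0
end

section
/- Let H be a group, φ an automorphism of H, and G = H ⋊_φ ℤ the semidirect product in which the generator 1 ∈ ℤ acts on H by φ. Suppose that the endomorphism of the abelianization H^{ab} sending the class of h to the class of φ(h)·h⁻¹ is surjective. Then the commutator subgroup of G equals the image of H under the canonical inclusion H → G, and the abelianization of G is infinite cyclic. -/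
/-- Let `H` be a group, `φ` an automorphism of `H`, and
`G = H ⋊_φ ℤ` the semidirect product in which `1 ∈ ℤ` acts by `φ`.  If the endomorphism of
`H^{ab}` sending the class of `h` to the class of `φ(h)·h⁻¹` is surjective, then the
commutator subgroup of `G` is the image of the canonical inclusion `H → G`, and the
abelianization of `G` is infinite cyclic. -/
theorem stmt_16 {H : Type*} [Group H] (φ : MulAut H)
    (hsurj : ∀ y : Abelianization H, ∃ h : H, Abelianization.of (φ h * h⁻¹) = y) :
    commutator (H ⋊[zpowersHom (MulAut H) φ] Multiplicative ℤ) =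
      (SemidirectProduct.inl :
        H →* H ⋊[zpowersHom (MulAut H) φ] Multiplicative ℤ).range ∧
    Nonempty (Abelianization (H ⋊[zpowersHom (MulAut H) φ] Multiplicative ℤ) ≃*
      Multiplicative ℤ) := by
  have key : commutator (H ⋊[zpowersHom (MulAut H) φ] Multiplicative ℤ) =
      (SemidirectProduct.inl :
        H →* H ⋊[zpowersHom (MulAut H) φ] Multiplicative ℤ).range := by
    apply le_antisymm
    · rw [SemidirectProduct.range_inl_eq_ker_rightHom]
      exact Abelianization.commutator_subset_ker _
    · rintro _ ⟨x, rfl⟩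
      obtain ⟨h, hh⟩ := hsurj (Abelianization.of x)
      let f : H →* Abelianization (H ⋊[zpowersHom (MulAut H) φ] Multiplicative ℤ) :=
        Abelianization.of.comp SemidirectProduct.inl
      have h1 : f (φ h) = f h := by
        have := SemidirectProduct.inl_aut (φ := zpowersHom (MulAut H) φ)
          (Multiplicative.ofAdd 1) h
        have e : zpowersHom (MulAut H) φ (Multiplicative.ofAdd 1) = φ := by
          simp [zpowersHom_apply]
        rw [e] at this
        simp only [f, MonoidHom.comp_apply]
        rw [this, map_mul, map_mul, mul_right_comm, ← map_mul, ← map_mul, ← map_mul]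
        simp
      have h2 : f x = 1 := by
        have h3 := congrArg (Abelianization.lift f) hh
        rw [Abelianization.lift_apply_of, Abelianization.lift_apply_of, map_mul, map_inv, h1,
          mul_inv_cancel] at h3
        exact h3.symm
      rw [← Abelianization.ker_of]
      exact h2
  refine ⟨key, ⟨?_⟩⟩
  exact (QuotientGroup.quotientMulEquivOfEq
    (key.trans SemidirectProduct.range_inl_eq_ker_rightHom)).trans
    (QuotientGroup.quotientKerEquivOfSurjective _ SemidirectProduct.rightHom_surjective)
end
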